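/- arXiv:2210.01793 — 3 statements merged into one kernel-verified Lean document; each statement's English description precedes it below -/
import Mathlib

section
/- For all integers k ≥ 3 and n ≥ 2, the number of spanning trees of the hinge graph H_{k,n} equals (k−1)^{n−1}·(k+n−1). -/
/-- Vertex set of the hinge graph `H_{k,n}`: two shared vertices `u, w`
(encoded as `Sum.inl 0`, `Sum.inl 1`) together with the vertices
`v_{i,j}` (encoded as `Sum.inr (i, j)`, zero-indexed). -/
abbrev HingeVertex (k n : ℕ) : Type := Fin 2 ⊕ (Fin n × Fin (k - 2))

/-- The shared vertex `u`. -/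
def hu (k n : ℕ) : HingeVertex k n := Sum.inl 0

/-- The shared vertex `w`. -/
def hw (k n : ℕ) : HingeVertex k n := Sum.inl 1

/-- The vertex `v_{i+1,j+1}` of the `i+1`-st cycle (zero-indexed here). -/
def hv (k n : ℕ) (i : Fin n) (j : Fin (k - 2)) : HingeVertex k n := Sum.inr (i, j)

/-- The base (Boolean) edge relation of the hinge graph: `u-w`, `u-v_{i,1}`,
`v_{i,j}-v_{i,j+1}`, `v_{i,k-2}-w`. -/
def hingeRelB (k n : ℕ) : HingeVertex k n → HingeVertex k n → Bool
  | Sum.inl a, Sum.inl b => a != b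
  | Sum.inl a, Sum.inr p => a == 0 && p.2.val == 0
  | Sum.inr p, Sum.inl b => b == 1 && p.2.val == k - 3
  | Sum.inr p, Sum.inr q => p.1 == q.1 && q.2.val == p.2.val + 1

/-- The hinge graph `H_{k,n}`: `n` cycles of length `k` glued along the edge `{u, w}`. -/
def Hinge (k n : ℕ) : SimpleGraph (HingeVertex k n) :=
  SimpleGraph.fromRel (fun x y => hingeRelB k n x y = true)

instance (k n : ℕ) : DecidableRel (Hinge k n).Adj := fun x y =>
  inferInstanceAs (Decidable (x ≠ y ∧ (hingeRelB k n x y = true ∨ hingeRelB k n y x = true)))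

/-- The number of spanning trees of a graph `G`: the number of edge sets `s ⊆ E(G)`
whose associated spanning subgraph (on all of `V`) is connected and acyclic. -/
noncomputable def spanningTreeCount {V : Type*} (G : SimpleGraph V) : ℕ :=
  Set.ncard {s : Set (Sym2 V) | s ⊆ G.edgeSet ∧ (SimpleGraph.fromEdgeSet s).IsTree}

/-- The degree homomorphism on divisors. -/
def degHom (V : Type*) [Fintype V] : (V → ℤ) →+ ℤ where
  toFun D := ∑ v, D v
  map_zero' := by simp
  map_add' x y := by simp [Finset.sum_add_distrib]

/-- The group `Div⁰` of degree-zero divisors. -/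
def Div0 (V : Type*) [Fintype V] : AddSubgroup (V → ℤ) := (degHom V).ker

/-- The group of principal divisors: the image of the Laplacian `L = Deg - A`. -/
def Prin {V : Type*} [Fintype V] [DecidableEq V] (G : SimpleGraph V) [DecidableRel G.Adj] :
    AddSubgroup (V → ℤ) :=
  AddMonoidHom.range (Matrix.mulVecLin (G.lapMatrix ℤ)).toAddMonoidHom

/-- The critical group `K(G) = Div⁰(G) / Prin(G)`. -/
def CriticalGroup {V : Type*} [Fintype V] [DecidableEq V] (G : SimpleGraph V)
    [DecidableRel G.Adj] : Type _ :=
  Div0 V ⧸ ((Prin G).addSubgroupOf (Div0 V))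

noncomputable instance {V : Type*} [Fintype V] [DecidableEq V] (G : SimpleGraph V)
    [DecidableRel G.Adj] : AddCommGroup (CriticalGroup G) :=
  inferInstanceAs (AddCommGroup (Div0 V ⧸ ((Prin G).addSubgroupOf (Div0 V))))

/-- The class of a degree-zero divisor in the critical group. -/
def divisorClass {V : Type*} [Fintype V] [DecidableEq V] (G : SimpleGraph V)
    [DecidableRel G.Adj] (D : V → ℤ) (hD : D ∈ Div0 V) : CriticalGroup G :=
  (QuotientAddGroup.mk (⟨D, hD⟩ : Div0 V) :
    Div0 V ⧸ ((Prin G).addSubgroupOf (Div0 V)))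

/-- The divisor with value `1` at `x`, `-1` at `y` (for `x ≠ y`) and `0` elsewhere. -/
def pointDiff {V : Type*} [DecidableEq V] (x y : V) : V → ℤ :=
  fun z => (if z = x then 1 else 0) - (if z = y then 1 else 0)

lemma pointDiff_mem {V : Type*} [Fintype V] [DecidableEq V] (x y : V) :
    pointDiff x y ∈ Div0 V := by
  simp [Div0, AddMonoidHom.mem_ker, degHom, pointDiff, Finset.sum_sub_distrib]

def pv (k n : ℕ) (i : Fin n) (t : ℕ) : HingeVertex k n :=
  if t = 0 then Sum.inl 0 else if h : t - 1 < k - 2 then Sum.inr (i, ⟨t - 1, h⟩) else Sum.inl 1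

def hedge (k n : ℕ) : Option (Fin n × Fin (k - 1)) → Sym2 (HingeVertex k n)
  | none => s(Sum.inl 0, Sum.inl 1)
  | some (i, j) => s(pv k n i j.val, pv k n i (j.val + 1))

lemma hedge_injective (k n : ℕ) (hk : 3 ≤ k) : Function.Injective (hedge k n) := by
  rintro (_ | ⟨i, ⟨j, hj⟩⟩) (_ | ⟨i', ⟨j', hj'⟩⟩) h
  · rfl
  all_goals
    simp only [hedge, pv] at h
    split_ifs at h <;> simp_all [Sym2.eq_iff] <;> grind

lemma hedge_range (k n : ℕ) (hk : 3 ≤ k) : Set.range (hedge k n) = (Hinge k n).edgeSet := by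
  ext z
  induction z using Sym2.ind with
  | _ x y =>
  simp only [SimpleGraph.mem_edgeSet, Hinge, SimpleGraph.fromRel_adj]
  constructor
  · rintro ⟨_ | ⟨i, ⟨j, hj⟩⟩, h⟩
    · simp only [hedge, Sym2.eq_iff] at h
      rcases h with ⟨rfl, rfl⟩ | ⟨rfl, rfl⟩ <;> simp [hingeRelB]
    · simp only [hedge, Sym2.eq_iff] at h
      have key : pv k n i j ≠ pv k n i (j+1) ∧
          hingeRelB k n (pv k n i j) (pv k n i (j+1)) = true := by
        simp only [pv]
        split_ifs <;> simp_all [hingeRelB] <;> omega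
      rcases h with ⟨rfl, rfl⟩ | ⟨rfl, rfl⟩
      · exact ⟨key.1, Or.inl key.2⟩
      · exact ⟨key.1.symm, Or.inr key.2⟩
  · rintro ⟨hne, h⟩
    have key : ∀ x y, x ≠ y → hingeRelB k n x y = true → ∃ a, hedge k n a = s(x, y) := by
      rintro (a | ⟨i, a⟩) (b | ⟨i', b⟩) hne h
      · refine ⟨none, ?_⟩
        fin_cases a <;> fin_cases b <;> simp_all [hedge]
      · simp [hingeRelB] at h
        refine ⟨some (i', ⟨0, by omega⟩), ?_⟩
        have : b = ⟨0, by omega⟩ := Fin.ext h.2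
        have : 0 < k - 2 := by omega
        simp_all [hedge, pv]
      · simp [hingeRelB] at h
        refine ⟨some (i, ⟨k - 2, by omega⟩), ?_⟩
        have : a = ⟨k - 3, by omega⟩ := Fin.ext h.2
        have : k - 2 ≠ 0 := by omega
        have : k - 2 - 1 = k - 3 := by omega
        have : k - 3 < k - 2 := by omega
        simp_all [hedge, pv]
      · simp [hingeRelB] at h
        obtain ⟨rfl, h⟩ := h
        refine ⟨some (i, ⟨b.val, by omega⟩), ?_⟩
        have e1 : pv k n i b.val = Sum.inr (i, a) := by
          have h1 : b.val ≠ 0 := by omega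
          have h2 : b.val - 1 < k - 2 := by omega
          have h3 : (⟨b.val - 1, h2⟩ : Fin (k - 2)) = a := Fin.ext (by simp; omega)
          rw [pv, if_neg h1, dif_pos h2, h3]
        have e2 : pv k n i (b.val + 1) = Sum.inr (i, b) := by simp [pv]
        simp only [hedge, e1, e2]
    rcases h with h | h
    · exact key _ _ hne h
    · rw [Sym2.eq_swap]; exact key _ _ hne.symm h

lemma reach_const {V : Type*} (G : SimpleGraph V) (P : V → Prop)
    (h : ∀ x y, G.Adj x y → (P x ↔ P y)) {x y : V} (hr : G.Reachable x y) : P x ↔ P y := by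
  obtain ⟨p⟩ := hr
  induction p with
  | nil => rfl
  | cons hadj _ ih => exact (h _ _ hadj).trans ih

/-- In a connected subgraph each path misses at most one edge. -/
lemma missing_le_one (k n : ℕ) (A : Set (Option (Fin n × Fin (k - 1))))
    (hc : (SimpleGraph.fromEdgeSet (hedge k n '' A)).Connected)
    (i : Fin n) (j j' : Fin (k - 1)) (hlt : j.val < j'.val)
    (hj : some (i, j) ∉ A) (hj' : some (i, j') ∉ A) : False := by
  let P : HingeVertex k n → Prop := fun v => ∃ a : Fin (k - 2), v = Sum.inr (i, a) ∧
    j.val ≤ a.val ∧ a.val < j'.val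
  have hadj : ∀ x y, (SimpleGraph.fromEdgeSet (hedge k n '' A)).Adj x y → (P x ↔ P y) := by
    intro x y h
    rw [SimpleGraph.fromEdgeSet_adj] at h
    obtain ⟨⟨a, haA, ha⟩, -⟩ := h
    rcases a with _ | ⟨i', t⟩
    · simp only [hedge, Sym2.eq_iff] at ha
      rcases ha with ⟨rfl, rfl⟩ | ⟨rfl, rfl⟩ <;> simp [P]
    · have key : P (pv k n i' t.val) ↔ P (pv k n i' (t.val + 1)) := by
        by_cases hi : i' = i
        · subst hi
          have h1 : t.val ≠ j.val := fun h => hj (Fin.ext h ▸ haA)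
          have h2 : t.val ≠ j'.val := fun h => hj' (Fin.ext h ▸ haA)
          have hP : ∀ s, s ≤ k - 1 → (P (pv k n i' s) ↔ j.val < s ∧ s ≤ j'.val) := by
            intro s hs
            simp only [P, pv]
            split_ifs with c1 c2
            · simp; omega
            · constructor
              · rintro ⟨a, h, h'⟩
                simp at h
                subst h
                simp at h'
                omega
              · intro h
                exact ⟨_, rfl, by simp; omega⟩
            · simp; omega
          rw [hP _ (by omega), hP _ (by omega)]
          omega
        · have : ∀ s, ¬ P (pv k n i' s) := by
            intro s
            simp only [P, pv]
            split_ifs <;> simp [hi]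
          simp [this]
      simp only [hedge, Sym2.eq_iff] at ha
      rcases ha with ⟨rfl, rfl⟩ | ⟨rfl, rfl⟩
      · exact key
      · exact key.symm
  have hr := reach_const _ P hadj
    (hc.preconnected (Sum.inl 0) (Sum.inr (i, ⟨j.val, by omega⟩)))
  have : P (Sum.inl 0) := hr.2 ⟨_, rfl, le_rfl, hlt⟩
  simp [P] at this

/-- Index set of edges: path `i` misses the edge `g i` if any; the hinge edge is present iff `b`. -/
def idx (k n : ℕ) (g : Fin n → Option (Fin (k - 1))) (b : Prop) :
    Set (Option (Fin n × Fin (k - 1))) :=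
  {a | match a with
    | none => b
    | some (i, j) => g i ≠ some j}

lemma idx_ncard (k n : ℕ) (g : Fin n → Option (Fin (k - 1))) (b : Prop) [Decidable b] :
    (idx k n g b).ncard + n =
      (if b then 1 else 0) + n * (k - 1) + (Finset.univ.filter (fun i => g i = none)).card := by
  classical
  have h1 : (idx k n g b).ncard = (if b then 1 else 0) +
      ∑ i : Fin n, ∑ j : Fin (k - 1), if g i ≠ some j then 1 else 0 := by
    have h0 : (idx k n g b) = ↑(Finset.univ.filter (fun a => a ∈ idx k n g b)) := by
      ext; simp
    rw [h0, Set.ncard_coe_finset, Finset.card_filter, Fintype.sum_option, Fintype.sum_prod_type]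
    have a1 : none ∈ idx k n g b ↔ b := Iff.rfl
    have a2 : ∀ i j, some (i, j) ∈ idx k n g b ↔ g i ≠ some j := fun _ _ => Iff.rfl
    simp only [a1, a2]
  have h2 : ∀ i, (∑ j : Fin (k - 1), if g i ≠ some j then 1 else 0) + 1 =
      (k - 1) + if g i = none then 1 else 0 := by
    intro i
    rcases hg : g i with _ | a
    · simp
    · simp [Finset.sum_ite, Finset.filter_ne]
      have := a.2
      omega
  have h3 := Finset.sum_congr (rfl : (Finset.univ : Finset (Fin n)) = _) (fun i _ => h2 i)
  simp only [Finset.sum_add_distrib] at h3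
  rw [Finset.card_filter]
  simp at h3 ⊢
  simp at h1
  omega

lemma connected_idx (k n : ℕ) (hk : 3 ≤ k) (hn : 2 ≤ n) (g : Fin n → Option (Fin (k - 1)))
    (b : Prop) (h : b ∨ ∃ i, g i = none) :
    (SimpleGraph.fromEdgeSet (hedge k n '' idx k n g b)).Connected := by
  set G := SimpleGraph.fromEdgeSet (hedge k n '' idx k n g b) with hG
  have step : ∀ i (t : Fin (k - 1)), g i ≠ some t →
      G.Reachable (pv k n i t.val) (pv k n i (t.val + 1)) := by
    intro i t ht
    by_cases he : pv k n i t.val = pv k n i (t.val + 1)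
    · rw [he]
    · apply SimpleGraph.Adj.reachable
      rw [hG, SimpleGraph.fromEdgeSet_adj]
      exact ⟨⟨some (i, t), ht, rfl⟩, he⟩
  have pv0 : ∀ i, pv k n i 0 = Sum.inl 0 := by intro i; simp [pv]
  have pvk : ∀ i, pv k n i (k - 1) = Sum.inl 1 := by
    intro i
    have : k - 1 ≠ 0 := by omega
    have : ¬ (k - 1 - 1 < k - 2) := by omega
    simp_all [pv]
  have up : ∀ i t, t ≤ k - 1 → (∀ j : Fin (k - 1), j.val < t → g i ≠ some j) →
      G.Reachable (Sum.inl 0) (pv k n i t) := by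
    intro i t
    induction t with
    | zero => intro _ _; rw [pv0]
    | succ t ih =>
      intro ht hj
      exact (ih (by omega) (fun j hjt => hj j (by omega))).trans
        (step i ⟨t, by omega⟩ (hj _ (by simp)))
  have down : ∀ i d t, t + d = k - 1 → (∀ j : Fin (k - 1), t ≤ j.val → g i ≠ some j) →
      G.Reachable (pv k n i t) (Sum.inl 1) := by
    intro i d
    induction d with
    | zero => intro t ht _; rw [← pvk i, ← ht]; rfl
    | succ d ih =>
      intro t ht hj
      exact (step i ⟨t, by omega⟩ (hj _ (by simp))).trans
        (ih (t + 1) (by omega) (fun j hjt => hj j (by omega)))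
  have huw : G.Reachable (Sum.inl 0) (Sum.inl 1) := by
    rcases h with h | ⟨i, hi⟩
    · apply SimpleGraph.Adj.reachable
      rw [hG, SimpleGraph.fromEdgeSet_adj]
      exact ⟨⟨none, h, rfl⟩, by simp⟩
    · have := up i (k - 1) le_rfl (by simp [hi])
      rwa [pvk] at this
  have all : ∀ v, G.Reachable (Sum.inl 0) v := by
    rintro (a | ⟨i, a⟩)
    · fin_cases a
      · rfl
      · exact huw
    · have hv : (Sum.inr (i, a) : HingeVertex k n) = pv k n i (a.val + 1) := by
        simp [pv]
      rw [hv]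
      by_cases hup : ∀ j : Fin (k - 1), j.val < a.val + 1 → g i ≠ some j
      · exact up i _ (by omega) hup
      · push Not at hup
        obtain ⟨j, hj, hgj⟩ := hup
        refine huw.trans (down i (k - 1 - (a.val + 1)) _ (by omega) ?_).symm
        intro j' hj' h'
        rw [hgj] at h'
        simp at h'
        subst h'
        omega
  haveI : Nonempty (HingeVertex k n) := ⟨Sum.inl 0⟩
  exact ⟨fun x y => (all x).symm.trans (all y)⟩

lemma tree_iff (k n : ℕ) (hk : 3 ≤ k) (A : Set (Option (Fin n × Fin (k - 1)))) :
    (SimpleGraph.fromEdgeSet (hedge k n '' A)).IsTree ↔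
      (SimpleGraph.fromEdgeSet (hedge k n '' A)).Connected ∧
      A.ncard + 1 = 2 + n * (k - 2) := by
  rw [SimpleGraph.isTree_iff_connected_and_card]
  have h1 : (SimpleGraph.fromEdgeSet (hedge k n '' A)).edgeSet = hedge k n '' A := by
    rw [SimpleGraph.edgeSet_fromEdgeSet, sdiff_eq_left, Set.disjoint_left]
    intro z hz
    have : z ∈ (Hinge k n).edgeSet := by
      rw [← hedge_range k n hk]; exact Set.image_subset_range _ _ hz
    exact SimpleGraph.not_isDiag_of_mem_edgeSet _ this
  rw [h1, Nat.card_coe_set_eq, Set.ncard_image_of_injective _ (hedge_injective k n hk)]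
  simp

lemma count_fun (n m : ℕ) :
    (Finset.univ.filter (fun g : Fin n → Option (Fin m) =>
      (Finset.univ.filter (fun i => g i = none)).card ≤ 1)).card = m ^ n + n * m ^ (n - 1) := by
  classical
  let T : Option (Fin n) → Finset (Fin n → Option (Fin m)) := fun x =>
    Fintype.piFinset (fun j => if some j = x then {none} else Finset.univ.erase none)
  have hT : ∀ x g, g ∈ T x ↔ ∀ j, g j = none ↔ some j = x := by
    intro x g
    simp only [T, Fintype.mem_piFinset]
    refine forall_congr' fun j => ?_
    split_ifs with h <;> simp [h]
  have : Finset.univ.filter (fun g : Fin n → Option (Fin m) =>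
      (Finset.univ.filter (fun i => g i = none)).card ≤ 1) = Finset.univ.biUnion T := by
    ext g
    simp only [Finset.mem_filter, Finset.mem_univ, true_and, Finset.mem_biUnion, hT]
    rw [Finset.card_le_one]
    constructor
    · intro h
      by_cases hx : ∃ i, g i = none
      · obtain ⟨i, hi⟩ := hx
        refine ⟨some i, fun j => ⟨fun hj => ?_, fun hj => ?_⟩⟩
        · rw [h j (by simpa using hj) i (by simpa using hi)]
        · simp at hj; rwa [hj]
      · push Not at hx
        exact ⟨none, fun j => by simp [hx]⟩
    · rintro ⟨x, hx⟩ a ha b hb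
      simp only [Finset.mem_filter, Finset.mem_univ, true_and] at ha hb
      have := ((hx a).1 ha).trans ((hx b).1 hb).symm
      simpa using this
  rw [this, Finset.card_biUnion]
  · simp only [T, Fintype.card_piFinset, Fintype.sum_option]
    congr 1
    · simp
    · have : ∀ i : Fin n, (∏ j : Fin n, (if some j = some i then ({none} : Finset (Option (Fin m)))
          else Finset.univ.erase none).card) = m ^ (n - 1) := by
        intro i
        rw [← Finset.mul_prod_erase _ _ (Finset.mem_univ i)]
        rw [Finset.prod_congr rfl (g := fun _ => m)]
        · simp
        · intro j hj
          simp at hj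
          simp [hj]
      rw [Finset.sum_congr rfl (fun i _ => this i)]
      simp
  · intro x _ y _ hxy
    rw [Function.onFun, Finset.disjoint_left]
    intro g hg hg'
    rw [hT] at hg hg'
    apply hxy
    ext j
    constructor
    · intro h; exact ((hg' j).1 ((hg j).2 h.symm)).symm
    · intro h; exact ((hg j).1 ((hg' j).2 h.symm)).symm

lemma idx_inj (k n : ℕ) (g g' : Fin n → Option (Fin (k - 1))) (b b' : Prop)
    (h : idx k n g b = idx k n g' b') : g = g' := by
  funext i
  ext j
  have := Set.ext_iff.1 h (some (i, j))
  simp only [idx, Set.mem_ofPred_eq] at this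
  exact not_iff_not.1 this

/-- For all integers `k ≥ 3` and `n ≥ 2`, the number of spanning trees of
the hinge graph `H_{k,n}` equals `(k-1)^(n-1) * (k+n-1)`. -/
theorem hinge_spanningTreeCount (k n : ℕ) (hk : 3 ≤ k) (hn : 2 ≤ n) :
    spanningTreeCount (Hinge k n) = (k - 1) ^ (n - 1) * (k + n - 1) := by
  classical
  have harith : n * (k - 1) = n * (k - 2) + n := by
    obtain ⟨q, rfl⟩ : ∃ q, k = q + 2 := ⟨k - 2, by omega⟩
    simp; ring
  let Φ : (Fin n → Option (Fin (k - 1))) → Set (Sym2 (HingeVertex k n)) :=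
    fun g => hedge k n '' idx k n g (∀ i, g i ≠ none)
  have hΦ : Function.Injective Φ := by
    intro g g' h
    exact idx_inj _ _ _ _ _ _ ((hedge_injective k n hk).image_injective h)
  have hset : {s : Set (Sym2 (HingeVertex k n)) | s ⊆ (Hinge k n).edgeSet ∧
      (SimpleGraph.fromEdgeSet s).IsTree} =
      Φ '' (↑(Finset.univ.filter (fun g : Fin n → Option (Fin (k - 1)) =>
      (Finset.univ.filter (fun i => g i = none)).card ≤ 1)) : Set _) := by
    ext s
    simp only [Set.mem_ofPred_eq, Set.mem_image, Finset.coe_filter, Finset.mem_univ, true_and]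
    constructor
    · rintro ⟨hs, ht⟩
      rw [← hedge_range k n hk] at hs
      obtain ⟨A, rfl⟩ := Set.subset_range_iff_exists_image_eq.1 hs
      rw [tree_iff k n hk] at ht
      obtain ⟨hc, hcard⟩ := ht
      have hm : ∀ i, ∃ o : Option (Fin (k - 1)), ∀ j, some (i, j) ∈ A ↔ o ≠ some j := by
        intro i
        by_cases hex : ∃ j, some (i, j) ∉ A
        · obtain ⟨j, hj⟩ := hex
          refine ⟨some j, fun j' => ⟨fun h h' => ?_, fun h => ?_⟩⟩
          · simp at h'; subst h'; exact hj h
          · by_contra hj'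
            have hne : j.val ≠ j'.val := fun h' => h (by rw [Fin.ext h'])
            rcases lt_or_gt_of_ne hne with hl | hl
            · exact missing_le_one k n A hc i j j' hl hj hj'
            · exact missing_le_one k n A hc i j' j hl hj' hj
        · push Not at hex
          exact ⟨none, fun j => by simp [hex]⟩
      choose g hg using hm
      have hA : A = idx k n g (none ∈ A) := by
        ext (_ | ⟨i, j⟩)
        · simp [idx]
        · simp only [idx, Set.mem_ofPred_eq]; exact hg i j
      have hN := idx_ncard k n g (none ∈ A)
      rw [← hA] at hN
      refine ⟨g, by split_ifs at hN <;> omega, ?_⟩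
      have hb : (∀ i, g i ≠ none) ↔ none ∈ A := by
        have h0 : (∀ i, g i ≠ none) ↔ (Finset.univ.filter (fun i => g i = none)).card = 0 := by
          simp [Finset.filter_eq_empty_iff]
        rw [h0]
        split_ifs at hN with hb
        · simp only [hb, iff_true]; omega
        · simp only [hb, iff_false]; omega
      simp only [Φ]
      rw [propext hb, ← hA]
    · rintro ⟨g, hg, rfl⟩
      refine ⟨by rw [← hedge_range k n hk]; exact Set.image_subset_range _ _, ?_⟩
      simp only [Φ]
      rw [tree_iff k n hk]
      refine ⟨connected_idx k n hk hn g _ ?_, ?_⟩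
      · by_cases h : ∃ i, g i = none
        · exact Or.inr h
        · push Not at h; exact Or.inl h
      · have hN := idx_ncard k n g (∀ i, g i ≠ none)
        have h0 : (∀ i, g i ≠ none) ↔ (Finset.univ.filter (fun i => g i = none)).card = 0 := by
          simp [Finset.filter_eq_empty_iff]
        split_ifs at hN with hb
        · have := h0.1 hb; omega
        · have := mt h0.2 hb; omega
  rw [spanningTreeCount, hset, Set.ncard_image_of_injective _ hΦ, Set.ncard_coe_finset, count_fun]
  obtain ⟨p, rfl⟩ : ∃ p, n = p + 1 := ⟨n - 1, by omega⟩
  obtain ⟨q, rfl⟩ : ∃ q, k = q + 1 := ⟨k - 1, by omega⟩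
  simp only [Nat.add_sub_cancel]
  have : q + 1 + (p + 1) - 1 = q + p + 1 := by omega
  rw [this]
  ring
end

section
/- For all integers k ≥ 3 and n ≥ 2, the number of spanning trees of the hinge graph H_{k,n+1} equals (k−1) times the number of spanning trees of H_{k,n}, plus (k−1)^n. -/
namespace HingeAux

/-- The `t`-th vertex of path `i` from `u` to `w`. -/
def pt (k n : ℕ) (i : Fin n) : ℕ → HingeVertex k n
  | 0 => Sum.inl 0
  | t + 1 => if h : t < k - 2 then Sum.inr (i, ⟨t, h⟩) else Sum.inl 1

/-- Labelled edges. -/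
def edge (k n : ℕ) : Option (Fin n × Fin (k - 1)) → Sym2 (HingeVertex k n)
  | none => s(Sum.inl 0, Sum.inl 1)
  | some (i, t) => s(pt k n i t, pt k n i (t + 1))

/-- Distance from `u` along the path. -/
def lev (k n : ℕ) : HingeVertex k n → ℕ
  | Sum.inl a => if a = 0 then 0 else k - 1
  | Sum.inr p => p.2.val + 1

lemma lev_pt (k n : ℕ) (i : Fin n) (hk : 3 ≤ k) (t : ℕ) (ht : t ≤ k - 1) :
    lev k n (pt k n i t) = t := by
  cases t with
  | zero => simp [pt, lev]
  | succ t =>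
    by_cases h : t < k - 2
    · simp [pt, lev, h]
    · simp [pt, lev, h]; omega

lemma pt_inj (k n : ℕ) (i i' : Fin n) (t : ℕ) (h0 : 0 < t) (ht : t < k - 1)
    (h : pt k n i t = pt k n i' t) : i = i' := by
  cases t with
  | zero => omega
  | succ t =>
    have h1 : t < k - 2 := by omega
    simpa [pt, h1] using h

lemma pt_last (k n : ℕ) (i : Fin n) (hk : 3 ≤ k) : pt k n i (k - 1) = Sum.inl 1 := by
  obtain ⟨m, rfl⟩ : ∃ m, k = m + 3 := ⟨k - 3, by omega⟩
  simp [pt]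

lemma edge_injective (k n : ℕ) (hk : 3 ≤ k) : Function.Injective (edge k n) := by
  have key : ∀ (i : Fin n) (t : Fin (k - 1)), edge k n none ≠ edge k n (some (i, t)) := by
    intro i t h
    have h1 := lev_pt k n i hk t (by omega)
    have h2 := lev_pt k n i hk (t + 1) (by omega)
    simp only [edge, Sym2.eq_iff] at h
    rcases h with ⟨a, b⟩ | ⟨a, b⟩
    · rw [← a] at h1
      rw [← b] at h2
      simp [lev] at h1 h2; omega
    · rw [← b] at h1
      rw [← a] at h2
      simp [lev] at h1 h2
  rintro (_ | ⟨i, t⟩) (_ | ⟨i', t'⟩) h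
  · rfl
  · exact absurd h (key _ _)
  · exact absurd h.symm (key _ _)
  · have h1 := lev_pt k n i hk t (by omega)
    have h2 := lev_pt k n i hk (t + 1) (by omega)
    have h3 := lev_pt k n i' hk t' (by omega)
    have h4 := lev_pt k n i' hk (t' + 1) (by omega)
    simp only [edge, Sym2.eq_iff] at h
    rcases h with ⟨a, b⟩ | ⟨a, b⟩
    · rw [a, h3] at h1
      have ht : t = t' := Fin.ext h1.symm
      subst ht
      have : i = i' := by
        rcases Nat.eq_zero_or_pos t.val with h0 | h0
        · exact pt_inj k n i i' (t + 1) (by omega) (by omega) b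
        · exact pt_inj k n i i' t h0 t.2 a
      rw [this]
    · rw [a, h4] at h1; rw [b, h3] at h2; omega

lemma edge_mem (k n : ℕ) (hk : 3 ≤ k) (a) : edge k n a ∈ (Hinge k n).edgeSet := by
  rcases a with (_ | ⟨i, t, ht⟩)
  · simp [edge, Hinge, hingeRelB]
  · rcases t with (_ | t)
    · have : 0 < k - 2 := by omega
      simp [edge, Hinge, hingeRelB, pt, this]
    · have h1 : t < k - 2 := by omega
      by_cases h2 : t + 1 < k - 2
      · simp [edge, Hinge, hingeRelB, pt, h1, h2]
      · simp [edge, Hinge, hingeRelB, pt, h1, h2]; omega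

lemma rel_mem (k n : ℕ) (hk : 3 ≤ k) (x y) (h : hingeRelB k n x y = true) :
    s(x, y) ∈ Set.range (edge k n) := by
  rcases x with a | ⟨i, t, ht⟩ <;> rcases y with b | ⟨i', t', ht'⟩
  · refine ⟨none, ?_⟩
    simp [hingeRelB] at h
    fin_cases a <;> fin_cases b <;> simp_all [edge]
  · simp [hingeRelB] at h
    obtain ⟨rfl, rfl⟩ := h
    exact ⟨some (i', ⟨0, by omega⟩), by simp [edge, pt, ht']⟩
  · simp [hingeRelB] at h
    obtain ⟨rfl, rfl⟩ := h
    refine ⟨some (i, ⟨k - 3 + 1, by omega⟩), ?_⟩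
    have : ¬ (k - 3 + 1 < k - 2) := by omega
    simp [edge, pt, ht, this]
  · simp [hingeRelB] at h
    obtain ⟨rfl, rfl⟩ := h
    exact ⟨some (i, ⟨t + 1, by omega⟩), by simp [edge, pt, ht, ht']⟩

lemma range_edge (k n : ℕ) (hk : 3 ≤ k) : Set.range (edge k n) = (Hinge k n).edgeSet := by
  ext x
  constructor
  · rintro ⟨a, rfl⟩; exact edge_mem k n hk a
  · induction x with | _ x y
    intro h
    simp [Hinge] at h
    rcases h.2 with h | h
    · simpa using rel_mem k n hk x y h
    · rw [Sym2.eq_swap]; exact rel_mem k n hk y x h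

/-- Missing label on path `i`. -/
def miss {n m : ℕ} (g : Fin n → Option (Fin m)) (i : Fin n) : Option (Fin n × Fin m) :=
  (g i).map (fun t => (i, t))

/-- At most one path is complete. -/
def Good {n m : ℕ} (g : Fin n → Option (Fin m)) : Prop :=
  ∀ a b, g a = none → g b = none → a = b

/-- The spanning tree attached to `g`. -/
def tr (k n : ℕ) (g : Fin n → Option (Fin (k - 1))) : Set (Sym2 (HingeVertex k n)) :=
  edge k n '' (Set.range (miss g))ᶜ

lemma some_mem_miss {n m : ℕ} (g : Fin n → Option (Fin m)) (i t) :
    some (i, t) ∈ Set.range (miss g) ↔ g i = some t := by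
  constructor
  · rintro ⟨i', h⟩
    simp [miss] at h
    obtain ⟨h, rfl⟩ := h
    exact h
  · intro h; exact ⟨i, by simp [miss, h]⟩

lemma none_mem_miss {n m : ℕ} (g : Fin n → Option (Fin m)) :
    none ∈ Set.range (miss g) ↔ ∃ i, g i = none := by
  simp [miss]

lemma miss_inj {n m : ℕ} (g : Fin n → Option (Fin m)) (hg : Good g) :
    Function.Injective (miss g) := by
  intro i i' h
  cases h1 : g i <;> cases h2 : g i' <;> simp [miss, h1, h2] at h
  · exact hg _ _ h1 h2
  · exact h.1

lemma tr_inj (k n : ℕ) (hk : 3 ≤ k) : Function.Injective (tr k n) := by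
  intro g g' h
  have h1 := compl_injective ((edge_injective k n hk).image_injective h)
  funext i
  apply Option.ext
  intro t
  have := Set.ext_iff.1 h1 (some (i, t))
  simpa only [some_mem_miss] using this

lemma tree_iff {k n : ℕ} (hk : 3 ≤ k) (M : Set (Option (Fin n × Fin (k - 1)))) :
    (SimpleGraph.fromEdgeSet (edge k n '' Mᶜ)).IsTree ↔
      (SimpleGraph.fromEdgeSet (edge k n '' Mᶜ)).Connected ∧ M.ncard = n := by
  classical
  rw [SimpleGraph.isTree_iff_connected_and_card]
  refine and_congr_right fun _ => ?_
  have h1 : (SimpleGraph.fromEdgeSet (edge k n '' Mᶜ)).edgeSet = edge k n '' Mᶜ := by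
    rw [SimpleGraph.edgeSet_fromEdgeSet, sdiff_eq_left, Set.disjoint_left]
    rintro _ ⟨a, _, rfl⟩ hd
    exact (Hinge k n).not_isDiag_of_mem_edgeSet (edge_mem k n hk a) hd
  rw [h1, Nat.card_coe_set_eq, Set.ncard_image_of_injective _ (edge_injective k n hk)]
  have h2 := Set.ncard_add_ncard_compl M
  simp at h2 ⊢
  obtain ⟨m, rfl⟩ : ∃ m, k = m + 3 := ⟨k - 3, by omega⟩
  simp [Nat.mul_add] at h2 ⊢
  omega

lemma tr_adj {k n : ℕ} (hk : 3 ≤ k) (g : Fin n → Option (Fin (k - 1))) (i : Fin n)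
    (t : ℕ) (ht : t < k - 1) (h : g i ≠ some ⟨t, ht⟩) :
    (SimpleGraph.fromEdgeSet (tr k n g)).Adj (pt k n i t) (pt k n i (t + 1)) := by
  have h1 := edge_mem k n hk (some (i, ⟨t, ht⟩))
  rw [SimpleGraph.fromEdgeSet_adj]
  refine ⟨⟨some (i, ⟨t, ht⟩), ?_, rfl⟩, ?_⟩
  · rw [Set.mem_compl_iff, some_mem_miss]; exact h
  · exact (SimpleGraph.mem_edgeSet _ |>.1 h1).ne

lemma tr_reach {k n : ℕ} (hk : 3 ≤ k) (g : Fin n → Option (Fin (k - 1))) (i : Fin n)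
    (a b : ℕ) (hab : a ≤ b) (hb : b ≤ k - 1)
    (h : ∀ t (ht : t < k - 1), a ≤ t → t < b → g i ≠ some ⟨t, ht⟩) :
    (SimpleGraph.fromEdgeSet (tr k n g)).Reachable (pt k n i a) (pt k n i b) := by
  induction b, hab using Nat.le_induction with
  | base => rfl
  | succ b hab ih =>
    exact (ih (by omega) (fun t ht h1 h2 => h t ht h1 (by omega))).trans
      (tr_adj hk g i b (by omega) (h b (by omega) hab (by omega))).reachable

lemma tr_connected {k n : ℕ} (hk : 3 ≤ k) (g : Fin n → Option (Fin (k - 1))) :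
    (SimpleGraph.fromEdgeSet (tr k n g)).Connected := by
  have full : ∀ i, g i = none → ∀ t, t ≤ k - 1 →
      (SimpleGraph.fromEdgeSet (tr k n g)).Reachable (Sum.inl 0) (pt k n i t) := by
    intro i hi t ht
    exact tr_reach hk g i 0 t (by omega) ht (by simp [hi])
  have uw : (SimpleGraph.fromEdgeSet (tr k n g)).Reachable (Sum.inl 0) (Sum.inl 1) := by
    by_cases h : ∃ i, g i = none
    · obtain ⟨i, hi⟩ := h
      rw [← pt_last k n i hk]
      exact full i hi _ le_rfl
    · apply SimpleGraph.Adj.reachable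
      rw [SimpleGraph.fromEdgeSet_adj]
      refine ⟨⟨none, ?_, rfl⟩, by simp⟩
      rw [Set.mem_compl_iff, none_mem_miss]; exact h
  have all : ∀ x, (SimpleGraph.fromEdgeSet (tr k n g)).Reachable (Sum.inl 0) x := by
    rintro (a | ⟨i, t, ht⟩)
    · fin_cases a
      · rfl
      · exact uw
    · have e : (Sum.inr (i, ⟨t, ht⟩) : HingeVertex k n) = pt k n i (t + 1) := by simp [pt, ht]
      rw [e]
      cases hg : g i with
      | none => exact full i hg _ (by omega)
      | some j =>
        by_cases h : t + 1 ≤ j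
        · refine tr_reach hk g i 0 (t + 1) (by omega) (by omega) ?_
          intro s hs _ h2 h3
          rw [hg] at h3
          have := congrArg Fin.val (Option.some.inj h3)
          simp at this; omega
        · refine uw.trans (SimpleGraph.Reachable.symm ?_)
          rw [← pt_last k n i hk]
          refine tr_reach hk g i (t + 1) (k - 1) (by omega) (by omega) ?_
          intro s hs _ h2 h3
          rw [hg] at h3
          have := congrArg Fin.val (Option.some.inj h3)
          simp at this; omega
  haveI : Nonempty (HingeVertex k n) := ⟨Sum.inl 0⟩
  exact ⟨fun x y => (all x).symm.trans (all y)⟩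

lemma tr_tree {k n : ℕ} (hk : 3 ≤ k) (g : Fin n → Option (Fin (k - 1))) (hg : Good g) :
    (SimpleGraph.fromEdgeSet (tr k n g)).IsTree := by
  unfold tr
  rw [tree_iff hk]
  refine ⟨tr_connected hk g, ?_⟩
  rw [← Set.image_univ, Set.ncard_image_of_injective _ (miss_inj g hg)]
  simp

lemma atmost {k n : ℕ} (hk : 3 ≤ k) (M : Set (Option (Fin n × Fin (k - 1))))
    (hc : (SimpleGraph.fromEdgeSet (edge k n '' Mᶜ)).Connected) (i : Fin n)
    (j j' : Fin (k - 1)) (hj : some (i, j) ∈ M) (hj' : some (i, j') ∈ M) : ¬ j < j' := by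
  intro hlt
  have hlt' : j.val < j'.val := hlt
  let c : HingeVertex k n → Prop := fun x => match x with
    | Sum.inl _ => False
    | Sum.inr p => p.1 = i ∧ j.val < p.2.val + 1 ∧ p.2.val + 1 ≤ j'.val
  have hcp : ∀ (i' : Fin n) (t : ℕ), t ≤ k - 1 →
      (c (pt k n i' t) ↔ i' = i ∧ j.val < t ∧ t ≤ j'.val) := by
    intro i' t ht
    cases t with
    | zero => simp [c, pt]
    | succ t =>
      by_cases h : t < k - 2
      · simp [c, pt, h]
      · simp [c, pt, h]; omega
  have hadj : ∀ x y, (SimpleGraph.fromEdgeSet (edge k n '' Mᶜ)).Adj x y → (c x ↔ c y) := by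
    intro x y h
    rw [SimpleGraph.fromEdgeSet_adj] at h
    obtain ⟨⟨a, ha, he⟩, _⟩ := h
    rcases a with (_ | ⟨i', t⟩)
    · simp only [edge, Sym2.eq_iff] at he
      rcases he with ⟨rfl, rfl⟩ | ⟨rfl, rfl⟩ <;> simp [c]
    · have key : c (pt k n i' t) ↔ c (pt k n i' (t + 1)) := by
        rw [hcp i' t (by omega), hcp i' (t + 1) (by omega)]
        refine and_congr_right fun hi => ?_
        subst hi
        have h1 : t ≠ j := by rintro rfl; exact ha hj
        have h2 : t ≠ j' := by rintro rfl; exact ha hj'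
        have h1' : t.val ≠ j.val := fun h => h1 (Fin.ext h)
        have h2' : t.val ≠ j'.val := fun h => h2 (Fin.ext h)
        omega
      simp only [edge, Sym2.eq_iff] at he
      rcases he with ⟨rfl, rfl⟩ | ⟨rfl, rfl⟩
      · exact key
      · exact key.symm
  have hr := hc.preconnected (pt k n i 0) (pt k n i j')
  rw [SimpleGraph.reachable_iff_reflTransGen] at hr
  have : c (pt k n i 0) ↔ c (pt k n i j') := by
    generalize pt k n i j' = y at hr
    induction hr with
    | refl => rfl
    | tail _ h ih => exact ih.trans (hadj _ _ h)
  rw [hcp i 0 (by omega), hcp i j' (by omega)] at this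
  simp at this
  omega

lemma tr_surj {k n : ℕ} (hk : 3 ≤ k) (s : Set (Sym2 (HingeVertex k n)))
    (hs : s ⊆ (Hinge k n).edgeSet) (ht : (SimpleGraph.fromEdgeSet s).IsTree) :
    ∃ g, Good g ∧ tr k n g = s := by
  classical
  obtain ⟨M, rfl⟩ : ∃ M : Set (Option (Fin n × Fin (k - 1))), s = edge k n '' Mᶜ := by
    refine ⟨(edge k n ⁻¹' s)ᶜ, ?_⟩
    rw [compl_compl, Set.image_preimage_eq_of_subset]
    rwa [range_edge k n hk]
  rw [tree_iff hk] at ht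
  obtain ⟨hc, hM⟩ := ht
  have uniq : ∀ i j j', some (i, j) ∈ M → some (i, j') ∈ M → j = j' := by
    intro i j j' h h'
    exact le_antisymm (not_lt.1 (atmost hk M hc i j' j h' h)) (not_lt.1 (atmost hk M hc i j j' h h'))
  let g : Fin n → Option (Fin (k - 1)) := fun i =>
    if h : ∃ j, some (i, j) ∈ M then some h.choose else none
  have hg : ∀ i j, g i = some j ↔ some (i, j) ∈ M := by
    intro i j
    by_cases h : ∃ j, some (i, j) ∈ M
    · simp only [g, h, dite_true, Option.some.injEq]
      constructor
      · rintro rfl; exact h.choose_spec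
      · intro h'; exact uniq i _ _ h.choose_spec h'
    · simp only [g, h, dite_false]
      push Not at h
      simp [h]
  have hgn : ∀ i, g i = none ↔ ∀ j, some (i, j) ∉ M := by
    intro i
    rw [Option.eq_none_iff_forall_ne_some]
    simp [hg]
  -- an injection out of `M`
  have cnt : ∀ i₀, g i₀ = none → none ∈ M ∧ ∀ i₁, g i₁ = none → i₁ = i₀ := by
    intro i₀ h0
    let f : Option (Fin n × Fin (k - 1)) → Fin n := fun a => (a.map Prod.fst).getD i₀
    have finj : Set.InjOn f M := by
      rintro (_ | ⟨i, j⟩) ha (_ | ⟨i', j'⟩) hb hab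
      · rfl
      · simp [f] at hab; subst hab; exact absurd hb ((hgn _).1 h0 _)
      · simp [f] at hab; subst hab; exact absurd ha ((hgn _).1 h0 _)
      · simp [f] at hab; subst hab; rw [uniq i j j' ha hb]
    have fsurj : f '' M = Set.univ := by
      apply Set.eq_of_subset_of_ncard_le (Set.subset_univ _)
      rw [Set.ncard_image_of_injOn finj, hM]; simp
    constructor
    · have : i₀ ∈ f '' M := by rw [fsurj]; trivial
      obtain ⟨(_ | ⟨i, j⟩), ha, hi⟩ := this
      · exact ha
      · simp [f] at hi; subst hi; exact absurd ha ((hgn _).1 h0 _)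
    · intro i₁ h1
      have : i₁ ∈ f '' M := by rw [fsurj]; trivial
      obtain ⟨(_ | ⟨i, j⟩), ha, hi⟩ := this
      · simpa [f] using hi.symm
      · simp [f] at hi; subst hi; exact absurd ha ((hgn _).1 h1 _)
  have good : Good g := fun i i' h h' => (cnt i' h').2 i h
  refine ⟨g, good, ?_⟩
  unfold tr
  congr 2
  refine Set.eq_of_subset_of_ncard_le ?_ ?_ (Set.toFinite _)
  · rintro _ ⟨i, rfl⟩
    cases h : g i with
    | none => simpa [miss, h] using (cnt i h).1
    | some j => simpa [miss, h] using (hg i j).1 h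
  · rw [← Set.image_univ, Set.ncard_image_of_injective _ (miss_inj g good)]
    simp [hM]

lemma count_eq (k n : ℕ) (hk : 3 ≤ k) : spanningTreeCount (Hinge k n) =
    Nat.card {g : Fin n → Option (Fin (k - 1)) // Good g} := by
  unfold spanningTreeCount
  have : {s : Set (Sym2 (HingeVertex k n)) | s ⊆ (Hinge k n).edgeSet ∧
      (SimpleGraph.fromEdgeSet s).IsTree} = tr k n '' {g | Good g} := by
    ext s
    constructor
    · rintro ⟨h1, h2⟩
      exact tr_surj hk s h1 h2
    · rintro ⟨g, hg, rfl⟩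
      refine ⟨?_, tr_tree hk g hg⟩
      rintro _ ⟨a, _, rfl⟩
      exact edge_mem k n hk a
  rw [this, Set.ncard_image_of_injective _ (tr_inj k n hk), ← Nat.card_coe_set_eq]
  rfl

/-- Decomposition according to the first path. -/
def dec (n m : ℕ) : (Fin m × {g : Fin n → Option (Fin m) // Good g}) ⊕ (Fin n → Fin m) →
    {g : Fin (n + 1) → Option (Fin m) // Good g}
  | Sum.inl p => ⟨Fin.cons (some p.1) p.2.1, by
      intro i i'
      refine Fin.cases ?_ (fun i => ?_) i
      · simp
      · refine Fin.cases ?_ (fun i' => ?_) i'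
        · simp
        · simpa using p.2.2 i i'⟩
  | Sum.inr f => ⟨Fin.cons none (fun i => some (f i)), by
      intro i i'
      refine Fin.cases ?_ (fun i => ?_) i
      · refine Fin.cases ?_ (fun i' => ?_) i' <;> simp
      · simp⟩

lemma dec_bij (n m : ℕ) : Function.Bijective (dec n m) := by
  constructor
  · rintro (⟨a, g, hg⟩ | f) (⟨a', g', hg'⟩ | f') h
    · have h' := congrArg Subtype.val h
      simp only [dec, Fin.cons_inj] at h'
      simpa using h'
    · have h' := congrFun (congrArg Subtype.val h) 0
      simp [dec] at h'
    · have h' := congrFun (congrArg Subtype.val h) 0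
      simp [dec] at h'
    · congr 1
      funext i
      have h' := congrFun (congrArg Subtype.val h) i.succ
      simpa [dec] using h'
  · rintro ⟨g, hg⟩
    cases h : g 0 with
    | none =>
      have : ∀ i : Fin n, ∃ t, g i.succ = some t := by
        intro i
        cases h' : g i.succ with
        | none => exact absurd (hg _ _ h h') (Fin.succ_ne_zero i).symm
        | some t => exact ⟨t, rfl⟩
      choose f hf using this
      refine ⟨Sum.inr f, Subtype.ext ?_⟩
      funext i
      refine Fin.cases ?_ (fun i => ?_) i
      · simp [dec, h]
      · simp [dec, hf]
    | some t =>
      refine ⟨Sum.inl (t, ⟨fun i => g i.succ, ?_⟩), Subtype.ext ?_⟩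
      · intro i i' h1 h2
        exact Fin.succ_injective _ (hg _ _ h1 h2)
      · funext i
        refine Fin.cases ?_ (fun i => ?_) i
        · simp [dec, h]
        · simp [dec]

end HingeAux

/-- For all integers `k ≥ 3` and `n ≥ 2`, the number of spanning trees of
`H_{k,n+1}` equals `(k-1)` times the number of spanning trees of `H_{k,n}`, plus `(k-1)^n`. -/
theorem hinge_spanningTreeCount_recursion (k n : ℕ) (hk : 3 ≤ k) (hn : 2 ≤ n) :
    spanningTreeCount (Hinge k (n + 1)) =
      (k - 1) * spanningTreeCount (Hinge k n) + (k - 1) ^ n := by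
  rw [HingeAux.count_eq k _ hk, HingeAux.count_eq k _ hk,
    ← Nat.card_congr (Equiv.ofBijective _ (HingeAux.dec_bij n (k - 1))), Nat.card_sum,
    Nat.card_prod]
  simp
end

section
/- For all integers k ≥ 3 and n ≥ 2, the critical group K(H_{k,n}) of the hinge graph H_{k,n} is a finite group of cardinality (k−1)^{n−1}·(k+n−1). -/
/-- Summation by parts. -/
lemma parts_sum (f : ℕ → ℤ) (m : ℕ) :
    ∑ j ∈ Finset.range m, ((m : ℤ) - j) * (2 * f (j + 1) - f j - f (j + 2)) =
      (m + 1) * (f 1 - f 0) - (f (m + 1) - f 0) := by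
  have key : ∀ m : ℕ, ∑ j ∈ Finset.range m, (2 * f (j + 1) - f j - f (j + 2)) =
      f 1 - f 0 - (f (m + 1) - f m) := by
    intro m
    induction m with
    | zero => simp
    | succ m ih => rw [Finset.sum_range_succ, ih]; ring
  induction m with
  | zero => simp
  | succ m ih =>
    have h : ∑ j ∈ Finset.range (m + 1), (((m + 1 : ℕ) : ℤ) - j) *
        (2 * f (j + 1) - f j - f (j + 2)) =
        ∑ j ∈ Finset.range m, ((m : ℤ) - j) * (2 * f (j + 1) - f j - f (j + 2)) +
        ∑ j ∈ Finset.range (m + 1), (2 * f (j + 1) - f j - f (j + 2)) := by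
      rw [Finset.sum_range_succ, Finset.sum_range_succ _ m, ← add_assoc,
        ← Finset.sum_add_distrib]
      congr 1
      · apply Finset.sum_congr rfl
        intro j _
        push_cast
        ring
      · push_cast
        ring
    rw [h, ih, key]
    push_cast
    ring

/-- The path through the `i`-th cycle as a sequence. -/
def pathSeq (m n : ℕ) (x : HingeVertex (m + 3) n → ℤ) (i : Fin n) : ℕ → ℤ
  | 0 => x (Sum.inl 0)
  | j + 1 => if h : j < m + 1 then x (Sum.inr (i, ⟨j, h⟩)) else x (Sum.inl 1)

lemma lap_eq {V : Type*} [Fintype V] [DecidableEq V] (G : SimpleGraph V)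
    [DecidableRel G.Adj] (x : V → ℤ) (v : V) :
    (G.lapMatrix ℤ).mulVec x v = ∑ w, if G.Adj v w then x v - x w else 0 := by
  rw [SimpleGraph.lapMatrix_mulVec_apply, ← Finset.sum_filter, Finset.sum_sub_distrib]
  simp [← SimpleGraph.neighborFinset_eq_filter]

lemma lap_u (m n : ℕ) (x : HingeVertex (m + 3) n → ℤ) :
    ((Hinge (m + 3) n).lapMatrix ℤ).mulVec x (Sum.inl 0) =
      (x (Sum.inl 0) - x (Sum.inl 1)) + ∑ i, (x (Sum.inl 0) - x (Sum.inr (i, ⟨0, by omega⟩))) := by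
  rw [lap_eq, Fintype.sum_sum_type, Fintype.sum_prod_type]
  congr 1
  · simp [Fin.sum_univ_two, Hinge, hingeRelB]
  · apply Finset.sum_congr rfl
    intro i _
    rw [Finset.sum_eq_single (⟨0, by omega⟩ : Fin (m + 3 - 2))]
    · simp [Hinge, hingeRelB]
    · rintro ⟨b, hb⟩ _ h
      have : b ≠ 0 := by simpa using h
      simp [Hinge, hingeRelB, this]
    · simp

lemma lap_v (m n : ℕ) (x : HingeVertex (m + 3) n → ℤ) (i : Fin n) (j : Fin (m + 1)) :
    ((Hinge (m + 3) n).lapMatrix ℤ).mulVec x (Sum.inr (i, j)) =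
      2 * pathSeq m n x i (j + 1) - pathSeq m n x i j - pathSeq m n x i (j + 2) := by
  rw [lap_eq, Fintype.sum_sum_type, Fintype.sum_prod_type]
  rw [Finset.sum_eq_single i]
  rotate_left
  · intro b _ hb
    apply Finset.sum_eq_zero
    intro c _
    simp [Hinge, hingeRelB, hb, hb.symm]
  · simp
  obtain ⟨j, hj⟩ := j
  have h1 : ∀ c : Fin (m + 3 - 2), (if (Hinge (m + 3) n).Adj (Sum.inr (i, ⟨j, hj⟩)) (Sum.inr (i, c))
      then x (Sum.inr (i, ⟨j, hj⟩)) - x (Sum.inr (i, c)) else 0) =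
      (fun c : ℕ => (if c = j + 1 then pathSeq m n x i (j + 1) - pathSeq m n x i (c + 1) else 0) +
      (if j = c + 1 then pathSeq m n x i (j + 1) - pathSeq m n x i (c + 1) else 0)) c := by
    rintro ⟨c, hc⟩
    have hc' : c < m + 1 := hc
    simp only [Hinge, hingeRelB, pathSeq, hc', hj, dif_pos, SimpleGraph.fromRel_adj]
    by_cases h1 : c = j + 1
    · subst h1; simp; omega
    · by_cases h2 : j = c + 1
      · subst h2; simp; omega
      · simp [h1, h2]
  rw [Finset.sum_congr rfl (fun c _ => h1 c), Fin.sum_univ_eq_sum_range (fun c : ℕ => (if c = j + 1 then pathSeq m n x i (j + 1) - pathSeq m n x i (c + 1) else 0) +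
      (if j = c + 1 then pathSeq m n x i (j + 1) - pathSeq m n x i (c + 1) else 0)),
    Finset.sum_add_distrib, Finset.sum_ite_eq', Fin.sum_univ_two]
  have h2 : ∑ c ∈ Finset.range (m + 3 - 2), (if j = c + 1 then pathSeq m n x i (j + 1) - pathSeq m n x i (c + 1) else 0)
     = if j = 0 then 0 else pathSeq m n x i (j + 1) - pathSeq m n x i j := by
    cases j with
    | zero => simp
    | succ j =>
      simp only [Nat.add_right_cancel_iff, Finset.sum_ite_eq]
      rw [if_pos (by simp; omega)]
      simp
  rw [h2]
  have h3 : (Hinge (m + 3) n).Adj (Sum.inr (i, ⟨j, hj⟩)) (Sum.inl 0) ↔ j = 0 := by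
    simp [Hinge, hingeRelB]
  have h4 : (Hinge (m + 3) n).Adj (Sum.inr (i, ⟨j, hj⟩)) (Sum.inl 1) ↔ j = m := by
    simp [Hinge, hingeRelB]
  simp only [h3, h4]
  have h5 : pathSeq m n x i (j + 1) = x (Sum.inr (i, ⟨j, hj⟩)) := by simp [pathSeq, hj]
  rw [← h5]
  have h6 : pathSeq m n x i 0 = x (Sum.inl 0) := rfl
  have h7 : pathSeq m n x i (m + 2) = x (Sum.inl 1) := by simp [pathSeq]
  rw [← h6, ← h7]
  have h8 : j + 1 ∈ Finset.range (m + 3 - 2) ↔ j ≠ m := by simp; omega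
  simp only [h8]
  by_cases hj0 : j = 0 <;> by_cases hjm : j = m
  · subst hj0; subst hjm; simp; ring
  · subst hj0; simp [hjm]; ring
  · subst hjm; simp [hj0]; ring
  · simp [hj0, hjm]; ring

lemma lap_sum {V : Type*} [Fintype V] [DecidableEq V] (G : SimpleGraph V)
    [DecidableRel G.Adj] (x : V → ℤ) : ∑ v, (G.lapMatrix ℤ).mulVec x v = 0 := by
  have h : ∑ v, (G.lapMatrix ℤ).mulVec x v = -∑ v, (G.lapMatrix ℤ).mulVec x v := by
    simp only [lap_eq]
    conv_lhs => rw [Finset.sum_comm]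
    rw [← Finset.sum_neg_distrib]
    apply Finset.sum_congr rfl
    intro v _
    rw [← Finset.sum_neg_distrib]
    apply Finset.sum_congr rfl
    intro w _
    simp only [G.adj_comm w v]
    split_ifs <;> ring
  omega

/-- The reduced lattice map. -/
def redMap (m n : ℕ) : (Fin n → ℤ) →ₗ[ℤ] (Fin n → ℤ) :=
  Matrix.toLin' (Matrix.of fun i j => (if i = j then ((m : ℤ) + 2) else 0) + 1)

lemma redMap_apply (m n : ℕ) (a : Fin n → ℤ) (i : Fin n) :
    redMap m n a i = (m + 2) * a i + ∑ j, a j := by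
  simp [redMap, Matrix.mulVec, dotProduct, add_mul, Finset.sum_add_distrib]

lemma redMap_det (m n : ℕ) (hn : 2 ≤ n) :
    LinearMap.det (redMap m n) = ((m : ℤ) + 2) ^ (n - 1) * (m + 2 + n) := by
  rw [redMap, LinearMap.det_toLin']
  apply Int.cast_injective (α := ℚ)
  have hm : (m : ℚ) + 2 ≠ 0 := by positivity
  rw [Int.cast_det]
  have : (Matrix.of fun i j : Fin n => (if i = j then ((m : ℤ) + 2) else 0) + 1).map
      (Int.cast : ℤ → ℚ) = ((m : ℚ) + 2) • ((1 : Matrix (Fin n) (Fin n) ℚ) +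
        Matrix.replicateCol Unit (fun _ : Fin n => ((m : ℚ) + 2)⁻¹) *
        Matrix.replicateRow Unit (fun _ : Fin n => (1 : ℚ))) := by
    ext i j
    by_cases h : i = j
    · subst h; simp [Matrix.mul_apply]; field_simp
    · simp [Matrix.mul_apply, h]; field_simp
  rw [this, Matrix.det_smul, Matrix.det_one_add_replicateCol_mul_replicateRow]
  obtain ⟨n, rfl⟩ : ∃ p, n = p + 1 := ⟨n - 1, by omega⟩
  simp [dotProduct, pow_succ]
  field_simp

lemma redMap_index (m n : ℕ) (hn : 2 ≤ n) :
    (redMap m n).toAddMonoidHom.range.index = (m + 2) ^ (n - 1) * (m + 2 + n) := by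
  have hd := redMap_det m n hn
  have h0 : LinearMap.det (redMap m n) ≠ 0 := by
    rw [hd]; positivity
  have hinj : Function.Injective (redMap m n) := by
    rw [redMap, LinearMap.det_toLin'] at h0
    rw [← LinearMap.ker_eq_bot, LinearMap.ker_eq_bot']
    intro v hv
    exact Matrix.eq_zero_of_mulVec_eq_zero h0 (by simpa [redMap] using hv)
  have h := Submodule.natAbs_det_equiv (LinearMap.range (redMap m n))
    (LinearEquiv.ofInjective (redMap m n) hinj)
  have h3 : Nat.card ((Fin n → ℤ) ⧸ LinearMap.range (redMap m n)) =
      (LinearMap.det (redMap m n)).natAbs := by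
    rw [← h]; congr 1
  rw [hd] at h3
  have h4 : (((m : ℤ) + 2) ^ (n - 1) * (m + 2 + n)).natAbs = (m + 2) ^ (n - 1) * (m + 2 + n) := by
    zify
    rw [abs_of_nonneg (by positivity)]
  rw [← h4, ← h3]
  rfl

/-- The reduction of a divisor to the cycle lattice. -/
def redDiv (m n : ℕ) : (HingeVertex (m + 3) n → ℤ) →+ (Fin n → ℤ) where
  toFun D i := ∑ j : Fin (m + 1), ((m : ℤ) + 1 - (j : ℕ)) * D (Sum.inr (i, j)) - D (Sum.inl 0)
  map_zero' := by ext; simp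
  map_add' x y := by
    ext i
    simp [mul_add, Finset.sum_add_distrib]
    ring

/-- Solution of the second order recursion. -/
def recSeq (a : ℤ) (d : ℕ → ℤ) : ℕ → ℤ
  | 0 => 0
  | 1 => a
  | j + 2 => 2 * recSeq a d (j + 1) - recSeq a d j - d j

lemma path_parts (m n : ℕ) (x D : HingeVertex (m + 3) n → ℤ) (i : Fin n)
    (h : ∀ j : Fin (m + 1), D (Sum.inr (i, j)) =
      2 * pathSeq m n x i (j + 1) - pathSeq m n x i j - pathSeq m n x i (j + 2)) :
    ∑ j : Fin (m + 1), ((m : ℤ) + 1 - (j : ℕ)) * D (Sum.inr (i, j)) =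
      (m + 2) * (x (Sum.inr (i, ⟨0, by omega⟩)) - x (Sum.inl 0)) -
        (x (Sum.inl 1) - x (Sum.inl 0)) := by
  have := parts_sum (pathSeq m n x i) (m + 1)
  simp only [h]
  rw [Fin.sum_univ_eq_sum_range (fun j => ((m : ℤ) + 1 - (j : ℕ)) * (2 * pathSeq m n x i (j + 1) - pathSeq m n x i j - pathSeq m n x i (j + 2)))]
  push_cast at this
  rw [this]
  simp only [pathSeq, Nat.zero_lt_succ, lt_irrefl, dif_pos, dif_neg, not_false_eq_true]
  ring

lemma prin_iff (m n : ℕ) (hn : 2 ≤ n) (D : HingeVertex (m + 3) n → ℤ)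
    (hD : D ∈ Div0 (HingeVertex (m + 3) n)) :
    D ∈ Prin (Hinge (m + 3) n) ↔ redDiv m n D ∈ (redMap m n).toAddMonoidHom.range := by
  constructor
  · rintro ⟨x, hx⟩
    have hx' : ∀ v, D v = ((Hinge (m + 3) n).lapMatrix ℤ).mulVec x v := fun v => by
      rw [← hx]; rfl
    refine ⟨fun i => x (Sum.inr (i, ⟨0, by omega⟩)) - x (Sum.inl 0), ?_⟩
    ext i
    change redMap m n _ i = ∑ j : Fin (m + 1), ((m : ℤ) + 1 - (j : ℕ)) * D (Sum.inr (i, j)) - D (Sum.inl 0)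
    rw [redMap_apply, path_parts m n x D i (fun j => by rw [hx', lap_v]), hx' (Sum.inl 0), lap_u]
    simp only [Finset.sum_sub_distrib]
    ring
  · rintro ⟨a, ha⟩
    have ha' : ∀ i, (m + 2) * a i + ∑ j, a j = ∑ j : Fin (m + 1), ((m : ℤ) + 1 - (j : ℕ)) * D (Sum.inr (i, j)) - D (Sum.inl 0) := by
      intro i
      rw [← redMap_apply]
      exact congrFun ha i
    let d : Fin n → ℕ → ℤ := fun i j => if h : j < m + 1 then D (Sum.inr (i, ⟨j, h⟩)) else 0
    let x : HingeVertex (m + 3) n → ℤ := Sum.elim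
      ![0, - D (Sum.inl 0) - ∑ j, a j] (fun p => recSeq (a p.1) (d p.1) (p.2 + 1))
    have hend : ∀ i, recSeq (a i) (d i) (m + 2) = - D (Sum.inl 0) - ∑ j, a j := by
      intro i
      have h1 := parts_sum (recSeq (a i) (d i)) (m + 1)
      have h2 := ha' i
      have h3 : ∑ j ∈ Finset.range (m + 1), (((m + 1 : ℕ) : ℤ) - j) *
        (2 * recSeq (a i) (d i) (j + 1) - recSeq (a i) (d i) j - recSeq (a i) (d i) (j + 2)) =
        ∑ j : Fin (m + 1), ((m : ℤ) + 1 - (j : ℕ)) * D (Sum.inr (i, j)) := by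
        rw [← Fin.sum_univ_eq_sum_range (fun j => (((m + 1 : ℕ) : ℤ) - j) *
        (2 * recSeq (a i) (d i) (j + 1) - recSeq (a i) (d i) j - recSeq (a i) (d i) (j + 2)))]
        apply Finset.sum_congr rfl
        intro j _
        have : d i j = D (Sum.inr (i, j)) := dif_pos j.isLt
        rw [recSeq, this]
        push_cast
        ring
      rw [h3] at h1
      simp only [recSeq] at h1 ⊢
      push_cast at h1
      linarith
    have hseq : ∀ i, ∀ j ≤ m + 2, pathSeq m n x i j = recSeq (a i) (d i) j := by
      intro i j hj
      cases j with
      | zero => simp [pathSeq, x, recSeq]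
      | succ j =>
        by_cases h : j < m + 1
        · simp [pathSeq, h, x]
        · obtain rfl : j = m + 1 := by omega
          rw [hend]
          simp [pathSeq, x]
    have hv : ∀ i (j : Fin (m + 1)), ((Hinge (m + 3) n).lapMatrix ℤ).mulVec x (Sum.inr (i, j)) =
        D (Sum.inr (i, j)) := by
      intro i j
      rw [lap_v, hseq i _ (by omega), hseq i _ (by omega), hseq i _ (by omega), recSeq]
      have : d i j = D (Sum.inr (i, j)) := dif_pos j.isLt
      rw [this]
      ring
    have hu : ((Hinge (m + 3) n).lapMatrix ℤ).mulVec x (Sum.inl 0) = D (Sum.inl 0) := by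
      rw [lap_u]
      simp [x, recSeq]
    have hw : ((Hinge (m + 3) n).lapMatrix ℤ).mulVec x (Sum.inl 1) = D (Sum.inl 1) := by
      have h1 := lap_sum (Hinge (m + 3) n) x
      have h2 : ∑ v, D v = 0 := hD
      rw [Fintype.sum_sum_type, Fin.sum_univ_two] at h1 h2
      have h3 : ∑ p, ((Hinge (m + 3) n).lapMatrix ℤ).mulVec x (Sum.inr p) =
          ∑ p, D (Sum.inr p) := Finset.sum_congr rfl (fun p _ => hv p.1 p.2)
      rw [h3, hu] at h1
      linarith
    refine ⟨x, ?_⟩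
    change ((Hinge (m + 3) n).lapMatrix ℤ).mulVec x = D
    ext v
    rcases v with v | ⟨i, j⟩
    · fin_cases v
      · exact hu
      · exact hw
    · exact hv i j

lemma redDiv_surj (m n : ℕ) :
    Function.Surjective ((redDiv m n).comp (Div0 (HingeVertex (m + 3) n)).subtype) := by
  intro c
  refine ⟨⟨Sum.elim ![0, -∑ i, c i] (fun p => if p.2.val = m then c p.1 else 0), ?_⟩, ?_⟩
  · change ∑ v, _ = (0 : ℤ)
    rw [Fintype.sum_sum_type, Fin.sum_univ_two, Fintype.sum_prod_type]
    have : ∀ i, ∑ j : Fin (m + 3 - 2), (if j.val = m then c i else 0) = c i := by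
      intro i
      rw [Fin.sum_univ_eq_sum_range (fun j => if j = m then c i else 0)]
      simp
    simp [this]
  · ext i
    change ∑ j : Fin (m + 1), ((m : ℤ) + 1 - (j : ℕ)) * (if j.val = m then c i else 0) - 0 = c i
    rw [Fin.sum_univ_eq_sum_range (fun j => ((m : ℤ) + 1 - (j : ℕ)) * (if j = m then c i else 0))]
    simp

/-- For all integers `k ≥ 3` and `n ≥ 2`, the critical group `K(H_{k,n})`
is a finite group of cardinality `(k-1)^(n-1) * (k+n-1)`. -/
theorem hinge_criticalGroup_card (k n : ℕ) (hk : 3 ≤ k) (hn : 2 ≤ n) :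
    Finite (CriticalGroup (Hinge k n)) ∧
      Nat.card (CriticalGroup (Hinge k n)) = (k - 1) ^ (n - 1) * (k + n - 1) := by
  obtain ⟨m, rfl⟩ : ∃ m, k = m + 3 := ⟨k - 3, by omega⟩
  have hsub : (Prin (Hinge (m + 3) n)).addSubgroupOf (Div0 _) =
      (redMap m n).toAddMonoidHom.range.comap
        ((redDiv m n).comp (Div0 (HingeVertex (m + 3) n)).subtype) := by
    ext ⟨D, hD⟩
    exact prin_iff m n hn D hD
  have hidx : Nat.card (CriticalGroup (Hinge (m + 3) n)) = (m + 2) ^ (n - 1) * (m + 2 + n) := by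
    change ((Prin (Hinge (m + 3) n)).addSubgroupOf (Div0 _)).index = _
    rw [hsub, AddSubgroup.index_comap_of_surjective _ (redDiv_surj m n), redMap_index m n hn]
  refine ⟨Nat.finite_of_card_ne_zero ?_, ?_⟩
  · rw [hidx]; positivity
  · rw [hidx]
    congr 1
    omega
end
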